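/- Non-negativity of conditional restricted mutual information: for all finite nonempty types 𝒞, 𝒜, ℬ, every strictly positive joint probability mass function p on 𝒞 × 𝒜 × ℬ, and every subset T ⊆ 𝒞, one has I_T(𝒞; ℬ | 𝒜) ≥ 0. -/

import Mathlib

/-- **Log-sum inequality**, in the form of nonnegativity of the Kullback–Leibler divergence of
positive weights of which the second have at most the total mass of the first. -/
theorem sum_mul_log_div_nonneg {ι : Type*} (s : Finset ι) {f g : ι → ℝ}
    (hf : ∀ i ∈ s, 0 < f i) (hg : ∀ i ∈ s, 0 < g i) (hfg : ∑ i ∈ s, g i ≤ ∑ i ∈ s, f i) :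
    0 ≤ ∑ i ∈ s, f i * Real.log (f i / g i) := by
  calc 0 ≤ ∑ i ∈ s, (f i - g i) := by rw [Finset.sum_sub_distrib]; linarith
    _ ≤ ∑ i ∈ s, f i * Real.log (f i / g i) := by
      refine Finset.sum_le_sum fun i hi => ?_
      have hfi := hf i hi
      calc f i - g i = f i * (1 - (f i / g i)⁻¹) := by rw [inv_div]; field_simp
        _ ≤ f i * Real.log (f i / g i) := by
          gcongr
          exact Real.one_sub_inv_le_log_of_pos (div_pos hfi (hg i hi))

/-- **Non-negativity of conditional restricted mutual information.**
For finite nonempty types `𝒞`, `𝒜`, `ℬ`, a strictly positive joint pmf `p` on `𝒞 × 𝒜 × ℬ`,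
and a subset `T ⊆ 𝒞`,
`I_T(𝒞; ℬ | 𝒜) = Σ_{c ∈ T} Σ_{a,b} p(c,a,b) · log( p(c,a,b) · p_𝒜(a) / (p_{𝒞𝒜}(c,a) · p_{𝒜ℬ}(a,b)) ) ≥ 0`. -/
theorem conditional_restricted_mutual_information_nonneg
    {𝒞 𝒜 ℬ : Type*} [Fintype 𝒞] [Fintype 𝒜] [Fintype ℬ]
    [Nonempty 𝒞] [Nonempty 𝒜] [Nonempty ℬ]
    (p : 𝒞 × 𝒜 × ℬ → ℝ) (hpos : ∀ x, 0 < p x) (hsum : ∑ x, p x = 1)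
    (T : Finset 𝒞) :
    0 ≤ ∑ c ∈ T, ∑ a, ∑ b, p (c, a, b) *
        Real.log (p (c, a, b) * (∑ c', ∑ b', p (c', a, b')) /
          ((∑ b', p (c, a, b')) * (∑ c', p (c', a, b)))) := by
  refine Finset.sum_nonneg fun c _ => Finset.sum_nonneg fun a _ => ?_
  set A := ∑ c', ∑ b', p (c', a, b') with hA
  set C := ∑ b', p (c, a, b')
  have hA_pos : 0 < A := Finset.sum_pos
    (fun _ _ => Finset.sum_pos (fun _ _ => hpos _) Finset.univ_nonempty) Finset.univ_nonempty
  have hC_pos : 0 < C := Finset.sum_pos (fun _ _ => hpos _) Finset.univ_nonempty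
  have hD_pos (b : ℬ) : 0 < ∑ c', p (c', a, b) :=
    Finset.sum_pos (fun _ _ => hpos _) Finset.univ_nonempty
  have h_mass : ∑ b, C * (∑ c', p (c', a, b)) / A = C := by
    rw [← Finset.sum_div, ← Finset.mul_sum, Finset.sum_comm, ← hA, mul_div_cancel_right₀ _ hA_pos.ne']
  have h := sum_mul_log_div_nonneg Finset.univ (f := fun b => p (c, a, b))
    (g := fun b => C * (∑ c', p (c', a, b)) / A) (fun _ _ => hpos _)
    (fun b _ => div_pos (mul_pos hC_pos (hD_pos b)) hA_pos) h_mass.le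
  simpa only [div_div_eq_mul_div] using h
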